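/- The distribution of the coefficients of BDes_n^{B−D,+}(t) is asymptotically normal as n → ∞, and likewise for BDes_n^{B−D,-}(t). Moreover, for n ≥ 3 the mean of the coefficient distribution of BDes_n^{B−D,±}(t) equals n/2, and for n ≥ 4 its variance equals (n+1)/12. -/

import Mathlib

open scoped BigOperators


/-- A model of the hyperoctahedral group `B_n`: a signed permutation is a permutation of
`{1,...,n}` together with a sign for each position; `π_i = ±σ(i)`. -/
abbrev BG (n : ℕ) := Equiv.Perm (Fin n) × (Fin n → Bool)

/-- The value `π_{i+1} ∈ {−n,...,−1,1,...,n}` of a signed permutation at (0-indexed) position `i`. -/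
def bval {n : ℕ} (π : BG n) (i : Fin n) : ℤ :=
  (if π.2 i then -1 else 1) * ((π.1 i : ℤ) + 1)

/-- The value `π_i` at 1-indexed position `i ∈ {1,...,n}`, with the convention `π_0 = 0`. -/
def bvalExt {n : ℕ} (π : BG n) (i : ℕ) : ℤ :=
  if h : 1 ≤ i ∧ i ≤ n then bval π ⟨i - 1, by omega⟩ else 0

/-- `des_B(π) = |{i ∈ {0,...,n−1} : π_i > π_{i+1}}|` with `π_0 = 0`. -/
def desB {n : ℕ} (π : BG n) : ℕ :=
  ((Finset.range n).filter (fun i => bvalExt π (i + 1) < bvalExt π i)).card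

/-- `asc_B(π) = n − des_B(π)`. -/
def ascB {n : ℕ} (π : BG n) : ℕ := n - desB π

/-- `negs(π) = |{i ∈ [n] : π_i < 0}|`. -/
def negs {n : ℕ} (π : BG n) : ℕ :=
  (Finset.univ.filter (fun i : Fin n => bval π i < 0)).card

/-- `inv_A(π) = |{1 ≤ i < j ≤ n : π_i > π_j}|` (usual order on `ℤ`). -/
def invAB {n : ℕ} (π : BG n) : ℕ :=
  (Finset.univ.filter (fun p : Fin n × Fin n => p.1 < p.2 ∧ bval π p.2 < bval π p.1)).card

/-- `inv_D(π) = inv_A(π) + |{1 ≤ i < j ≤ n : −π_i > π_j}|`. -/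
def invDB {n : ℕ} (π : BG n) : ℕ :=
  invAB π +
    (Finset.univ.filter (fun p : Fin n × Fin n => p.1 < p.2 ∧ bval π p.2 < -bval π p.1)).card

/-- `inv_B(π) = inv_A(π) + |{1 ≤ i < j ≤ n : −π_i > π_j}| + negs(π)`. -/
def invBB {n : ℕ} (π : BG n) : ℕ := invDB π + negs π

/-- `exc_B(π) = |{i ∈ [n] : π_{|π_i|} > π_i}| + |{i ∈ [n] : π_i = −i}|`. -/
def excB {n : ℕ} (π : BG n) : ℕ :=
  (Finset.univ.filter (fun i : Fin n => bval π i < bvalExt π (bval π i).natAbs)).card +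
    (Finset.univ.filter (fun i : Fin n => bval π i = -((i : ℤ) + 1))).card

/-- The cumulative distribution function of the standard normal distribution. -/
noncomputable def stdNormalCDF (x : ℝ) : ℝ :=
  ∫ t in Set.Iic x, Real.exp (-t ^ 2 / 2) / Real.sqrt (2 * Real.pi)

/-- Row sum `Sum_n = Σ_k s_{n,k}` of a triangular array of counts. -/
noncomputable def rowSum (c : ℕ → ℕ → ℕ) (n : ℕ) : ℝ := ∑' k : ℕ, (c n k : ℝ)

/-- Mean `Σ_k k·s_{n,k}/Sum_n` of row `n`. -/
noncomputable def rowMean (c : ℕ → ℕ → ℕ) (n : ℕ) : ℝ :=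
  (∑' k : ℕ, (k : ℝ) * (c n k : ℝ)) / rowSum c n

/-- Variance `Σ_k k²·s_{n,k}/Sum_n − (mean)²` of row `n`. -/
noncomputable def rowVar (c : ℕ → ℕ → ℕ) (n : ℕ) : ℝ :=
  (∑' k : ℕ, (k : ℝ) ^ 2 * (c n k : ℝ)) / rowSum c n - rowMean c n ^ 2

/-- `Σ_{k ≤ ⌊y⌋} s_{n,k} / Sum_n` (for `k : ℕ`, `k ≤ ⌊y⌋ ↔ (k:ℝ) ≤ y`). -/
noncomputable def rowCDF (c : ℕ → ℕ → ℕ) (n : ℕ) (y : ℝ) : ℝ :=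
  (∑' k : ℕ, if (k : ℝ) ≤ y then (c n k : ℝ) else 0) / rowSum c n

/-- The triangular array `c` is asymptotically normal:
`lim_n sup_x |Σ_{k ≤ ⌊xσ_n + μ_n⌋} s_{n,k}/Sum_n − Φ(x)| = 0`, where `μ_n`, `σ_n²` are
the mean and variance of row `n`. -/
def IsAsympNormal (c : ℕ → ℕ → ℕ) : Prop :=
  Filter.Tendsto
    (fun n => ⨆ x : ℝ,
      |rowCDF c n (x * Real.sqrt (rowVar c n) + rowMean c n) - stdNormalCDF x|)
    Filter.atTop (nhds 0)

/-- Number of `π ∈ (B_n − D_n)^+` with `des_B(π) = k`. -/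
def cBDesBDP (n k : ℕ) : ℕ :=
  (Finset.univ.filter
    (fun π : BG n => ¬ Even (negs π) ∧ Even (invDB π) ∧ desB π = k)).card

/-- Number of `π ∈ (B_n − D_n)^-` with `des_B(π) = k`. -/
def cBDesBDM (n k : ℕ) : ℕ :=
  (Finset.univ.filter
    (fun π : BG n => ¬ Even (negs π) ∧ ¬ Even (invDB π) ∧ desB π = k)).card

open MeasureTheory ProbabilityTheory Filter Topology

/-- Pólya's theorem: pointwise convergence of monotone functions with values in `[0, 1]` to a
continuous distribution function is uniform. -/
theorem tendstoUniformly_of_monotone_of_tendsto {F : ℕ → ℝ → ℝ} {Φ : ℝ → ℝ}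
    (hF : ∀ n, Monotone (F n)) (hF0 : ∀ n x, 0 ≤ F n x) (hF1 : ∀ n x, F n x ≤ 1)
    (hΦ : Monotone Φ) (hc : Continuous Φ)
    (hbot : Tendsto Φ atBot (𝓝 0)) (htop : Tendsto Φ atTop (𝓝 1))
    (h : ∀ x, Tendsto (fun n => F n x) atTop (𝓝 (Φ x))) :
    TendstoUniformly F Φ atTop := by
  have h0 (x) : 0 ≤ Φ x := hΦ.le_of_tendsto hbot x
  have h1 (x) : Φ x ≤ 1 := hΦ.ge_of_tendsto htop x
  have surj {c : ℝ} (hc0 : 0 < c) (hc1 : c < 1) : ∃ x, Φ x = c := by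
    obtain ⟨a, ha⟩ := (hbot.eventually (gt_mem_nhds hc0)).exists
    obtain ⟨b, hb⟩ := (htop.eventually (lt_mem_nhds hc1)).exists
    exact mem_range_of_exists_le_of_exists_ge hc ⟨a, ha.le⟩ ⟨b, hb.le⟩
  rw [Metric.tendstoUniformly_iff]
  intro ε hε
  obtain ⟨K, hK⟩ := exists_nat_gt (4 / ε)
  have hK0 : (0 : ℝ) < K := lt_of_le_of_lt (by positivity) hK
  have hKε : 4 / (K : ℝ) < ε := by
    rw [div_lt_iff₀ hε] at hK
    rw [div_lt_iff₀ hK0]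
    linarith
  have ex (k : ℕ) : ∃ x, 0 < k → k < K → Φ x = k / K := by
    by_cases hk : 0 < k ∧ k < K
    · obtain ⟨x, hx⟩ := surj (c := k / K) (div_pos (by exact_mod_cast hk.1) hK0)
        ((div_lt_one hK0).2 (by exact_mod_cast hk.2))
      exact ⟨x, fun _ _ => hx⟩
    · exact ⟨0, fun a b => absurd ⟨a, b⟩ hk⟩
  choose g hg using ex
  have ev : ∀ᶠ n in atTop, ∀ k ∈ Finset.range K, |F n (g k) - Φ (g k)| < 1 / K := by
    rw [eventually_all_finset]
    intro k _
    have := (Metric.tendsto_nhds.1 (h (g k))) (1 / K) (by positivity)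
    simpa [Real.dist_eq] using this
  filter_upwards [ev] with n hn x
  obtain ⟨k, hk⟩ : ∃ k : ℕ, k = ⌊K * Φ x⌋₊ := ⟨_, rfl⟩
  have hk1 : (k : ℝ) / K ≤ Φ x := by
    rw [div_le_iff₀ hK0, hk, mul_comm (Φ x)]
    exact Nat.floor_le (mul_nonneg hK0.le (h0 x))
  have hk2 : Φ x < (k + 1) / K := by
    rw [lt_div_iff₀ hK0, hk, mul_comm (Φ x)]
    exact Nat.lt_floor_add_one _
  have hkK : k ≤ K := by
    have : (k : ℝ) / K ≤ 1 := hk1.trans (h1 x)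
    rw [div_le_one hK0] at this
    exact_mod_cast this
  have hinv : 0 < 1 / (K : ℝ) := by positivity
  have e4 : 4 / (K : ℝ) = 4 * (1 / K) := by ring
  have ek : ((k : ℝ) + 1) / K = k / K + 1 / K := by ring
  have lower : Φ x - 3 * (1 / K) ≤ F n x := by
    by_cases hk2' : 2 ≤ k
    · have hgk := hg (k - 1) (by omega) (by omega)
      have hcast : ((k - 1 : ℕ) : ℝ) / K = k / K - 1 / K := by
        rw [Nat.cast_sub (by omega)]; push_cast; ring
      have hle : g (k - 1) ≤ x := by
        by_contra! hlt
        have := hΦ hlt.le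
        linarith
      have a := abs_lt.1 (hn (k - 1) (Finset.mem_range.2 (by omega)))
      have b := hF n hle
      linarith
    · have : (k : ℝ) / K ≤ 1 / K := by
        gcongr
        exact_mod_cast (by omega : k ≤ 1)
      have := hF0 n x
      linarith
  have upper : F n x ≤ Φ x + 2 * (1 / K) := by
    by_cases hk2' : k + 1 < K
    · have hgk := hg (k + 1) (by omega) hk2'
      push_cast at hgk
      have hle : x ≤ g (k + 1) := by
        by_contra! hlt
        have := hΦ hlt.le
        linarith
      have a := abs_lt.1 (hn (k + 1) (Finset.mem_range.2 hk2'))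
      have b := hF n hle
      linarith
    · have : 1 ≤ ((k : ℝ) + 1) / K := by
        rw [one_le_div hK0]
        exact_mod_cast (by omega : K ≤ k + 1)
      have := hF1 n x
      linarith
  rw [Real.dist_eq, abs_lt]
  constructor <;> linarith

theorem continuous_cdf (μ : Measure ℝ) [IsProbabilityMeasure μ] [NullSingletonClass μ] :
    Continuous (cdf μ) := by
  rw [continuous_iff_continuousAt]
  intro x
  rw [(monotone_cdf μ).continuousAt_iff_leftLim_eq_rightLim, StieltjesFunction.rightLim_eq]
  have h := (cdf μ).measure_singleton x
  rw [measure_cdf, measure_singleton, eq_comm, ENNReal.ofReal_eq_zero] at h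
  exact le_antisymm ((monotone_cdf μ).leftLim_le le_rfl) (by linarith)

theorem stdNormalCDF_eq_cdf : stdNormalCDF = cdf (gaussianReal 0 1) := by
  funext x
  rw [cdf_eq_real, measureReal_def, gaussianReal_apply_eq_integral 0 one_ne_zero,
    ENNReal.toReal_ofReal
      (integral_nonneg fun t => gaussianPDFReal_nonneg 0 1 t)]
  unfold stdNormalCDF
  congr 1
  funext t
  simp [gaussianPDFReal, div_eq_inv_mul]

theorem tsum_mul_card_filter_eq {α : Type*} (S : Finset α) (d : α → ℕ) (h : ℕ → ℝ) :
    ∑' k, h k * ((S.filter (fun a => d a = k)).card : ℝ) = ∑ a ∈ S, h (d a) := by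
  rw [tsum_eq_sum (s := S.image d)]
  · rw [← Finset.sum_fiberwise_of_maps_to (fun a ha => Finset.mem_image_of_mem d ha)]
    refine Finset.sum_congr rfl fun k _ => ?_
    rw [Finset.sum_congr rfl (g := fun _ => h k)
      (fun a ha => by rw [(Finset.mem_filter.1 ha).2]), Finset.sum_const, nsmul_eq_mul, mul_comm]
  · intro k hk
    rw [Finset.filter_eq_empty_iff.2, Finset.card_empty, Nat.cast_zero, mul_zero]
    rintro a ha rfl
    exact hk (Finset.mem_image_of_mem d ha)

namespace BG

variable {n : ℕ}

/-- The product of the signs of a sign vector. -/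
def signProd (δ : Fin n → Bool) : ℤˣ := ∏ i, if δ i then -1 else 1

theorem bval_ne_zero (π : BG n) (i : Fin n) : bval π i ≠ 0 := by
  unfold bval
  split_ifs <;> omega

theorem abs_bval (π : BG n) (i : Fin n) : |bval π i| = (π.1 i : ℤ) + 1 := by
  unfold bval
  have : (0 : ℤ) ≤ (π.1 i : ℤ) + 1 := by positivity
  split_ifs
  · rw [neg_one_mul, abs_neg, abs_of_nonneg this]
  · rw [one_mul, abs_of_nonneg this]

theorem neg_one_pow_card_filter {α : Type*} (S : Finset α) (p : α → Prop) [DecidablePred p] :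
    (-1 : ℤˣ) ^ (S.filter p).card = ∏ a ∈ S, if p a then -1 else 1 := by
  rw [Finset.prod_ite, Finset.prod_const, Finset.prod_const_one, mul_one]

theorem neg_one_pow_negs (π : BG n) : (-1 : ℤˣ) ^ negs π = signProd π.2 := by
  rw [negs, neg_one_pow_card_filter, signProd]
  refine Finset.prod_congr rfl fun i _ => ?_
  unfold bval
  rcases h : π.2 i <;> simp <;> omega

theorem neg_one_pow_invDB (π : BG n) : (-1 : ℤˣ) ^ invDB π = Equiv.Perm.sign π.1 := by
  rw [invDB, invAB, pow_add, neg_one_pow_card_filter, neg_one_pow_card_filter,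
    ← Finset.prod_mul_distrib, Equiv.Perm.sign_eq_prod_prod_Ioi, Fintype.prod_prod_type]
  refine Finset.prod_congr rfl fun i _ => ?_
  rw [← Finset.filter_lt_eq_Ioi, Finset.prod_filter]
  refine Finset.prod_congr rfl fun j _ => ?_
  by_cases hij : i < j
  · have hne : π.1 i ≠ π.1 j := fun h => hij.ne (π.1.injective h)
    have hne' : (π.1 i : ℕ) ≠ π.1 j := fun h => hne (Fin.ext h)
    simp only [hij, true_and, if_true, bval, Fin.lt_def]
    rcases π.2 i <;> rcases π.2 j <;> simp only [Bool.false_eq_true, if_true, if_false] <;>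
      split_ifs <;> first | rfl | omega
  · simp [hij]

/-- Signed permutations with prescribed product of signs and prescribed sign of the underlying
permutation. -/
def signClass (n : ℕ) (e s : ℤˣ) : Finset (BG n) :=
  Finset.univ.filter fun π => signProd π.2 = e ∧ Equiv.Perm.sign π.1 = s

theorem mem_signClass {e s : ℤˣ} {π : BG n} :
    π ∈ signClass n e s ↔ signProd π.2 = e ∧ Equiv.Perm.sign π.1 = s := by
  simp [signClass]

/-- Permute the positions by `τ`, then change the signs at the positions marked by `δ`. -/
def act (τ : Equiv.Perm (Fin n)) (δ : Fin n → Bool) (π : BG n) : BG n :=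
  (π.1 * τ, fun i => xor (π.2 (τ i)) (δ i))

theorem act_injective (τ : Equiv.Perm (Fin n)) (δ : Fin n → Bool) :
    Function.Injective (act τ δ) := by
  rintro ⟨σ, ε⟩ ⟨σ', ε'⟩ h
  simp only [act, Prod.mk.injEq] at h
  obtain ⟨h1, h2⟩ := h
  refine Prod.ext (mul_right_cancel h1) (funext fun i => ?_)
  have := congrFun h2 (τ.symm i)
  simpa using this

theorem bval_act (τ : Equiv.Perm (Fin n)) (δ : Fin n → Bool) (π : BG n) (i : Fin n) :
    bval (act τ δ π) i = (if δ i then -1 else 1) * bval π (τ i) := by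
  simp only [bval, act, Equiv.Perm.mul_apply]
  rcases Bool.eq_false_or_eq_true (π.2 (τ i)) with h1 | h1 <;>
    rcases Bool.eq_false_or_eq_true (δ i) with h2 | h2 <;> simp [h1, h2]

theorem signProd_act (τ : Equiv.Perm (Fin n)) (δ : Fin n → Bool) (π : BG n) :
    signProd (act τ δ π).2 = signProd π.2 * signProd δ := by
  unfold signProd
  rw [← Equiv.prod_comp τ (fun i => if π.2 i then (-1 : ℤˣ) else 1), ← Finset.prod_mul_distrib]
  refine Finset.prod_congr rfl fun i _ => ?_
  simp only [act]
  rcases Bool.eq_false_or_eq_true (π.2 (τ i)) with h1 | h1 <;>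
    rcases Bool.eq_false_or_eq_true (δ i) with h2 | h2 <;> simp [h1, h2]

theorem act_mem_signClass {τ : Equiv.Perm (Fin n)} {δ : Fin n → Bool} {e s : ℤˣ} {π : BG n} :
    act τ δ π ∈ signClass n (e * signProd δ) (s * Equiv.Perm.sign τ) ↔ π ∈ signClass n e s := by
  rw [mem_signClass, mem_signClass, signProd_act]
  simp [act]

theorem sum_act_of_even {R : Type*} [AddCommMonoid R] {τ : Equiv.Perm (Fin n)}
    {δ : Fin n → Bool} (hτ : Equiv.Perm.sign τ = 1) (hδ : signProd δ = 1) (e s : ℤˣ)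
    (g : BG n → R) :
    ∑ π ∈ signClass n e s, g (act τ δ π) = ∑ π ∈ signClass n e s, g π := by
  refine Finset.sum_bijective (act τ δ) (Finite.injective_iff_bijective.1 (act_injective τ δ))
    (fun π => ?_) (fun _ _ => rfl)
  rw [← act_mem_signClass (τ := τ) (δ := δ), hτ, hδ, mul_one, mul_one]

theorem bvalExt_zero (π : BG n) : bvalExt π 0 = 0 := by simp [bvalExt]

theorem bvalExt_succ (π : BG n) {k : ℕ} (hk : k < n) : bvalExt π (k + 1) = bval π ⟨k, hk⟩ := by
  simp [bvalExt, hk]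

theorem bvalExt_ne_succ (π : BG n) {k : ℕ} (hk : k < n) : bvalExt π k ≠ bvalExt π (k + 1) := by
  rw [bvalExt_succ π hk]
  rcases k with _ | k
  · rw [bvalExt_zero]
    exact (bval_ne_zero π _).symm
  · rw [bvalExt_succ π (by omega)]
    intro h
    have h2 := congrArg abs h
    rw [abs_bval, abs_bval] at h2
    have := π.1.injective (Fin.ext (by exact_mod_cast add_right_cancel h2))
    simp at this

/-- `1` at a descent and `-1` at an ascent. -/
def desSign (π : BG n) (k : ℕ) : ℤ := Int.sign (bvalExt π k - bvalExt π (k + 1))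

theorem sum_desSign (π : BG n) : ∑ k ∈ Finset.range n, desSign π k = 2 * desB π - n := by
  have : ∀ k ∈ Finset.range n, desSign π k =
      2 * (if bvalExt π (k + 1) < bvalExt π k then 1 else 0) - 1 := by
    intro k hk
    have hne := bvalExt_ne_succ π (Finset.mem_range.1 hk)
    unfold desSign
    split_ifs with h
    · rw [Int.sign_eq_one_of_pos (by omega)]; rfl
    · rw [Int.sign_eq_neg_one_of_neg (by omega)]; rfl
  rw [Finset.sum_congr rfl this, Finset.sum_sub_distrib, ← Finset.mul_sum, Finset.sum_boole]
  simp [desB]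

theorem signProd_false : signProd (fun _ : Fin n => false) = 1 := by simp [signProd]

theorem signProd_pair {a b : Fin n} (h : a ≠ b) :
    signProd (fun i => decide (i = a ∨ i = b)) = 1 := by
  have : Finset.univ.filter (fun i => i = a ∨ i = b) = {a, b} := by ext; simp
  unfold signProd
  simp only [decide_eq_true_eq]
  rw [← neg_one_pow_card_filter, this, Finset.card_pair h]
  rfl

theorem sign_cases {x : ℤ} (hx : x ≠ 0) : Int.sign x = 1 ∧ 0 < x ∨ Int.sign x = -1 ∧ x < 0 := by
  rcases lt_or_gt_of_ne hx with h | h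
  · exact .inr ⟨Int.sign_eq_neg_one_of_neg h, h⟩
  · exact .inl ⟨Int.sign_eq_one_of_pos h, h⟩

theorem sign_mul_sign_cyclic {a b c : ℤ} (hab : a ≠ b) (hbc : b ≠ c) (hca : c ≠ a) :
    (a - b).sign * (b - c).sign + (b - c).sign * (c - a).sign + (c - a).sign * (a - b).sign
      = -1 := by
  rcases sign_cases (sub_ne_zero.2 hab) with ⟨h1, h1'⟩ | ⟨h1, h1'⟩ <;>
  rcases sign_cases (sub_ne_zero.2 hbc) with ⟨h2, h2'⟩ | ⟨h2, h2'⟩ <;>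
  rcases sign_cases (sub_ne_zero.2 hca) with ⟨h3, h3'⟩ | ⟨h3, h3'⟩ <;>
  rw [h1, h2, h3] <;> omega

theorem sign_mul_sign_signed {a b : ℤ} (ha : a ≠ 0) (hb : b ≠ 0) (hab : |a| ≠ |b|) :
    (0 - a).sign * (a - b).sign + (0 - a).sign * (a - -b).sign +
      ((0 - b).sign * (b - a).sign + (0 - b).sign * (b - -a).sign) = -2 := by
  have h₁ : a ≠ b := fun h => hab (by rw [h])
  have h₂ : a ≠ -b := fun h => hab (by rw [h, abs_neg])
  rcases sign_cases (sub_ne_zero.2 ha.symm) with ⟨h1, h1'⟩ | ⟨h1, h1'⟩ <;>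
  rcases sign_cases (sub_ne_zero.2 hb.symm) with ⟨h2, h2'⟩ | ⟨h2, h2'⟩ <;>
  rcases sign_cases (sub_ne_zero.2 h₁) with ⟨h3, h3'⟩ | ⟨h3, h3'⟩ <;>
  rcases sign_cases (sub_ne_zero.2 h₂) with ⟨h4, h4'⟩ | ⟨h4, h4'⟩ <;>
  rcases sign_cases (sub_ne_zero.2 h₁.symm) with ⟨h5, h5'⟩ | ⟨h5, h5'⟩ <;>
  rcases sign_cases (show b - -a ≠ 0 by omega) with ⟨h6, h6'⟩ | ⟨h6, h6'⟩ <;>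
  rw [h1, h2, h3, h4, h5, h6] <;> omega

theorem abs_bval_ne (π : BG n) {i j : Fin n} (h : i ≠ j) : |bval π i| ≠ |bval π j| := by
  rw [abs_bval, abs_bval]
  intro h2
  exact h (π.1.injective (Fin.ext (by exact_mod_cast add_right_cancel h2)))

theorem bval_ne (π : BG n) {i j : Fin n} (h : i ≠ j) : bval π i ≠ bval π j :=
  fun h2 => abs_bval_ne π h (by rw [h2])

theorem desSign_zero (π : BG n) (h : 0 < n) : desSign π 0 = (0 - bval π ⟨0, h⟩).sign := by
  rw [desSign, bvalExt_zero, bvalExt_succ π h]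

theorem desSign_succ (π : BG n) {k : ℕ} (h : k + 1 < n) :
    desSign π (k + 1) = (bval π ⟨k, by omega⟩ - bval π ⟨k + 1, h⟩).sign := by
  rw [desSign, bvalExt_succ π h, bvalExt_succ π]

theorem desSign_mul_self (π : BG n) {k : ℕ} (h : k < n) : desSign π k * desSign π k = 1 := by
  rcases sign_cases (sub_ne_zero.2 (bvalExt_ne_succ π h)) with ⟨h1, -⟩ | ⟨h1, -⟩ <;>
    rw [desSign, h1] <;> rfl

/-- Changing the signs at two consecutive positions exchanges descent and ascent. -/
theorem desSign_act_pair_self (π : BG n) {k : ℕ} (h : k + 1 < n) :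
    desSign (act 1 (fun i => decide (i = ⟨k, by omega⟩ ∨ i = ⟨k + 1, h⟩)) π) (k + 1)
      = -desSign π (k + 1) := by
  rw [desSign_succ _ h, desSign_succ _ h, ← Int.sign_neg]
  simp only [bval_act]
  simp
  congr 1
  ring

theorem desSign_act_pair_of_lt (π : BG n) {i k : ℕ} (h : k + 1 < n) (hi : i < k) :
    desSign (act 1 (fun i => decide (i = ⟨k, by omega⟩ ∨ i = ⟨k + 1, h⟩)) π) i
      = desSign π i := by
  rcases i with _ | i
  · rw [desSign_zero _ (by omega), desSign_zero _ (by omega), bval_act]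
    simp [hi.ne]
  · rw [desSign_succ _ (by omega), desSign_succ _ (by omega), bval_act, bval_act]
    simp [hi.ne, (show i ≠ k by omega), (show i ≠ k + 1 by omega)]

variable (e s : ℤˣ)

theorem sum_desSign_eq_zero (hn : 2 ≤ n) {k : ℕ} (hk : k < n) :
    ∑ π ∈ signClass n e s, desSign π k = 0 := by
  rcases k with _ | k
  · have h := sum_act_of_even (τ := 1) (Equiv.Perm.sign_one)
      (signProd_pair (a := (⟨0, by omega⟩ : Fin n)) (b := ⟨1, by omega⟩) (by simp)) e s
      (fun π => desSign π 0)
    have h2 (π : BG n) : desSign (act 1 (fun i => decide (i = (⟨0, by omega⟩ : Fin n) ∨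
        i = ⟨1, by omega⟩)) π) 0 = -desSign π 0 := by
      rw [desSign_zero _ hk, desSign_zero _ hk, bval_act, ← Int.sign_neg]
      simp
    simp only [h2, Finset.sum_neg_distrib] at h
    omega
  · have h := sum_act_of_even (τ := 1) (Equiv.Perm.sign_one)
      (signProd_pair (a := (⟨k, by omega⟩ : Fin n)) (b := ⟨k + 1, hk⟩) (by simp)) e s
      (fun π => desSign π (k + 1))
    simp only [desSign_act_pair_self, Finset.sum_neg_distrib] at h
    omega

theorem sum_desSign_mul_eq_zero {i j : ℕ} (hij : i + 2 ≤ j) (hj : j < n) :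
    ∑ π ∈ signClass n e s, desSign π i * desSign π j = 0 := by
  obtain ⟨k, rfl⟩ : ∃ k, j = k + 1 := ⟨j - 1, by omega⟩
  have h := sum_act_of_even (τ := 1) (Equiv.Perm.sign_one)
    (signProd_pair (a := (⟨k, by omega⟩ : Fin n)) (b := ⟨k + 1, hj⟩) (by simp)) e s
    (fun π => desSign π i * desSign π (k + 1))
  have h2 (π : BG n) := desSign_act_pair_of_lt π hj (show i < k by omega)
  simp only [desSign_act_pair_self, h2, mul_neg, Finset.sum_neg_distrib] at h
  omega

theorem sum_desSign_mul_succ {k : ℕ} (hk : k + 2 < n) :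
    3 * ∑ π ∈ signClass n e s, desSign π (k + 1) * desSign π (k + 2)
      = -(signClass n e s).card := by
  let a : Fin n := ⟨k, by omega⟩
  let b : Fin n := ⟨k + 1, by omega⟩
  let c : Fin n := ⟨k + 2, by omega⟩
  have hab : a ≠ b := by simp [a, b]
  have hbc : b ≠ c := by simp [b, c]
  have hca : c ≠ a := by simp [c, a]
  let τ : Equiv.Perm (Fin n) := Equiv.swap a b * Equiv.swap b c
  have hτ : Equiv.Perm.sign τ = 1 := by simp [τ, hab, hbc]
  have τa : τ a = b := by simp [τ, Equiv.swap_apply_of_ne_of_ne hab hca.symm]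
  have τb : τ b = c := by
    simp [τ, Equiv.swap_apply_of_ne_of_ne hca hbc.symm]
  have τc : τ c = a := by simp [τ]
  let g : BG n → ℤ := fun π => desSign π (k + 1) * desSign π (k + 2)
  have hg (π : BG n) : g π = (bval π a - bval π b).sign * (bval π b - bval π c).sign := by
    simp only [g, a, b, c]
    rw [desSign_succ _ (by omega), desSign_succ _ (by omega)]
  have s1 := sum_act_of_even hτ (signProd_false (n := n)) e s g
  have s2 := sum_act_of_even hτ (signProd_false (n := n)) e s
    (fun π => g (act τ (fun _ => false) π))
  have key : ∀ π ∈ signClass n e s, g π + g (act τ (fun _ => false) π) +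
      g (act τ (fun _ => false) (act τ (fun _ => false) π)) = -1 := by
    intro π _
    simp only [hg, bval_act, τa, τb, τc, Bool.false_eq_true, if_false, one_mul]
    exact sign_mul_sign_cyclic (bval_ne π hab) (bval_ne π hbc) (bval_ne π hca)
  have := Finset.sum_congr rfl key
  rw [Finset.sum_add_distrib, Finset.sum_add_distrib, s2, s1, Finset.sum_const,
    nsmul_eq_mul] at this
  change 3 * ∑ π ∈ signClass n e s, g π = _
  linarith

theorem sum_desSign_zero_mul_one (hn : 4 ≤ n) :
    2 * ∑ π ∈ signClass n e s, desSign π 0 * desSign π 1 = -(signClass n e s).card := by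
  let a : Fin n := ⟨0, by omega⟩
  let b : Fin n := ⟨1, by omega⟩
  let c : Fin n := ⟨2, by omega⟩
  let d : Fin n := ⟨3, by omega⟩
  have hab : a ≠ b := by simp [a, b]
  have hac : a ≠ c := by simp [a, c]
  have had : a ≠ d := by simp [a, d]
  have hbc : b ≠ c := by simp [b, c]
  have hbd : b ≠ d := by simp [b, d]
  have hcd : c ≠ d := by simp [c, d]
  let τ : Equiv.Perm (Fin n) := Equiv.swap a b * Equiv.swap c d
  have hτ : Equiv.Perm.sign τ = 1 := by simp [τ, hab, hcd]
  have τa : τ a = b := by simp [τ, Equiv.swap_apply_of_ne_of_ne hac had]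
  have τb : τ b = a := by simp [τ, Equiv.swap_apply_of_ne_of_ne hbc hbd]
  let δ : Fin n → Bool := fun i => decide (i = b ∨ i = c)
  have δa : δ a = false := by simp [δ, hab, hac]
  have δb : δ b = true := by simp [δ]
  let g : BG n → ℤ := fun π => desSign π 0 * desSign π 1
  have hg (π : BG n) : g π = (0 - bval π a).sign * (bval π a - bval π b).sign := by
    simp only [g, a, b]
    rw [desSign_zero _ (by omega), desSign_succ _ (by omega)]
  have s1 := sum_act_of_even Equiv.Perm.sign_one (signProd_pair hbc) e s g
  have s2 := sum_act_of_even hτ (signProd_false (n := n)) e s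
    (fun π => g π + g (act 1 δ π))
  have key : ∀ π ∈ signClass n e s, g π + g (act 1 δ π) +
      (g (act τ (fun _ => false) π) + g (act 1 δ (act τ (fun _ => false) π))) = -2 := by
    intro π _
    simp only [hg, bval_act, τa, τb, δa, δb, Bool.false_eq_true, if_false, if_true, one_mul,
      Equiv.Perm.one_apply, neg_one_mul]
    exact sign_mul_sign_signed (bval_ne_zero π a) (bval_ne_zero π b) (abs_bval_ne π hab)
  have := Finset.sum_congr rfl key
  rw [Finset.sum_add_distrib, s2, Finset.sum_add_distrib, Finset.sum_const, nsmul_eq_mul] at this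
  change 2 * ∑ π ∈ signClass n e s, g π = _
  change ∑ π ∈ signClass n e s, g (act 1 δ π) = _ at s1
  linarith

theorem sum_two_mul_desB_sub (hn : 2 ≤ n) :
    ∑ π ∈ signClass n e s, (2 * (desB π : ℤ) - n) = 0 := by
  simp only [← sum_desSign]
  rw [Finset.sum_comm]
  exact Finset.sum_eq_zero fun k hk => sum_desSign_eq_zero e s hn (Finset.mem_range.1 hk)

theorem sum_desSign_mul_sum (hn : 4 ≤ n) {m : ℕ} (hm : m + 2 ≤ n) :
    3 * ∑ π ∈ signClass n e s, (∑ k ∈ Finset.range (m + 2), desSign π k) ^ 2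
      = ((m : ℤ) + 3) * (signClass n e s).card := by
  induction m with
  | zero =>
    have h := sum_desSign_zero_mul_one e s hn
    have key : ∀ π ∈ signClass n e s, (∑ k ∈ Finset.range 2, desSign π k) ^ 2
        = 2 + 2 * (desSign π 0 * desSign π 1) := by
      intro π _
      have h0 := desSign_mul_self π (show 0 < n by omega)
      have h1 := desSign_mul_self π (show 1 < n by omega)
      simp only [Finset.sum_range_succ, Finset.sum_range_zero]
      linear_combination h0 + h1
    rw [zero_add, Finset.sum_congr rfl key, Finset.sum_add_distrib, ← Finset.mul_sum, h,
      Finset.sum_const, nsmul_eq_mul]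
    push_cast
    ring
  | succ m ih =>
    have h := sum_desSign_mul_succ e s (show m + 2 < n by omega)
    have key : ∀ π ∈ signClass n e s, (∑ k ∈ Finset.range (m + 1 + 2), desSign π k) ^ 2
        = (∑ k ∈ Finset.range (m + 2), desSign π k) ^ 2 + 1
          + 2 * (∑ k ∈ Finset.range (m + 1), desSign π k * desSign π (m + 2))
          + 2 * (desSign π (m + 1) * desSign π (m + 2)) := by
      intro π _
      have h0 := desSign_mul_self π (show m + 2 < n by omega)
      rw [← Finset.sum_mul, show m + 1 + 2 = m + 1 + 1 + 1 from rfl]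
      simp only [Finset.sum_range_succ]
      linear_combination h0
    have hz : ∑ π ∈ signClass n e s,
        ∑ k ∈ Finset.range (m + 1), desSign π k * desSign π (m + 2) = 0 := by
      rw [Finset.sum_comm]
      exact Finset.sum_eq_zero fun k hk =>
        sum_desSign_mul_eq_zero e s (by have := Finset.mem_range.1 hk; omega) (by omega)
    rw [Finset.sum_congr rfl key, Finset.sum_add_distrib, Finset.sum_add_distrib,
      Finset.sum_add_distrib, ← Finset.mul_sum, ← Finset.mul_sum, hz, Finset.sum_const,
      nsmul_eq_mul]
    push_cast
    linarith [ih (by omega)]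

theorem sum_two_mul_desB_sub_sq (hn : 4 ≤ n) :
    3 * ∑ π ∈ signClass n e s, (2 * (desB π : ℤ) - n) ^ 2 =
      ((n : ℤ) + 1) * (signClass n e s).card := by
  obtain ⟨m, rfl⟩ : ∃ m, n = m + 2 := ⟨n - 2, by omega⟩
  simp only [← sum_desSign]
  rw [sum_desSign_mul_sum e s hn le_rfl]
  push_cast
  ring

end BG

namespace BG

variable {n : ℕ}

theorem exists_act_fixing (hn : 2 ≤ n) (u v : ℤˣ) :
    ∃ (τ : Equiv.Perm (Fin n)) (δ : Fin n → Bool), Equiv.Perm.sign τ = u ∧ signProd δ = v ∧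
      ∀ i : Fin n, 2 ≤ (i : ℕ) → τ i = i ∧ δ i = false := by
  have h1 : ∃ τ : Equiv.Perm (Fin n), Equiv.Perm.sign τ = u ∧
      ∀ i : Fin n, 2 ≤ (i : ℕ) → τ i = i := by
    rcases Int.units_eq_one_or u with rfl | rfl
    · exact ⟨1, by simp, by simp⟩
    · refine ⟨Equiv.swap ⟨0, by omega⟩ ⟨1, by omega⟩, Equiv.Perm.sign_swap (by simp),
        fun i hi => Equiv.swap_apply_of_ne_of_ne ?_ ?_⟩ <;>
      · rintro rfl
        simp at hi
  have h2 : ∃ δ : Fin n → Bool, signProd δ = v ∧ ∀ i : Fin n, 2 ≤ (i : ℕ) → δ i = false := by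
    rcases Int.units_eq_one_or v with rfl | rfl
    · exact ⟨fun _ => false, signProd_false, by simp⟩
    · refine ⟨fun i => decide (i = ⟨0, by omega⟩), ?_, fun i hi => ?_⟩
      · simp [signProd, Finset.prod_ite_eq']
      · simp only [decide_eq_false_iff_not]
        rintro rfl
        simp at hi
  obtain ⟨τ, hτ, hτ'⟩ := h1
  obtain ⟨δ, hδ, hδ'⟩ := h2
  exact ⟨τ, δ, hτ, hδ, fun i hi => ⟨hτ' i hi, hδ' i hi⟩⟩

theorem desB_le_of_bval_eq {π π' : BG n} (h : ∀ i : Fin n, 2 ≤ (i : ℕ) → bval π i = bval π' i) :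
    desB π ≤ desB π' + 3 := by
  have hk {k : ℕ} (hk : 2 ≤ k) (hkn : k < n) : bvalExt π (k + 1) = bvalExt π' (k + 1) := by
    rw [bvalExt_succ _ hkn, bvalExt_succ _ hkn, h _ hk]
  have hsub : (Finset.range n).filter (fun i => bvalExt π (i + 1) < bvalExt π i) ⊆
      (Finset.range n).filter (fun i => bvalExt π' (i + 1) < bvalExt π' i) ∪ Finset.range 3 := by
    intro i hi
    simp only [Finset.mem_union, Finset.mem_filter, Finset.mem_range] at hi ⊢
    by_cases h3 : i < 3
    · exact .inr h3
    · obtain ⟨k, rfl⟩ : ∃ k, i = k + 1 := ⟨i - 1, by omega⟩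
      rw [hk (by omega) hi.1, hk (k := k) (by omega) (by omega)] at hi
      exact .inl hi
  have := (Finset.card_le_card hsub).trans (Finset.card_union_le _ _)
  rwa [Finset.card_range] at this

theorem desB_le (π : BG n) : desB π ≤ n :=
  (Finset.card_filter_le _ _).trans_eq (Finset.card_range n)

theorem card_filter_desB_le (hn : 2 ≤ n) (e s e' s' : ℤˣ) (y : ℝ) :
    ((signClass n e s).filter fun π => (desB π : ℝ) ≤ y).card ≤
      ((signClass n e' s').filter fun π => (desB π : ℝ) ≤ y + 3).card := by
  obtain ⟨τ, δ, hτ, hδ, hfix⟩ := exists_act_fixing hn (s⁻¹ * s') (e⁻¹ * e')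
  refine Finset.card_le_card_of_injOn (act τ δ) (fun π hπ => ?_) (act_injective τ δ).injOn
  simp only [Finset.coe_filter, Set.mem_ofPred_eq] at hπ ⊢
  have hle : desB (act τ δ π) ≤ desB π + 3 := desB_le_of_bval_eq fun i hi => by
    rw [bval_act, (hfix i hi).1, (hfix i hi).2]
    simp
  refine ⟨?_, ?_⟩
  · have := (act_mem_signClass (τ := τ) (δ := δ)).2 hπ.1
    rwa [hτ, hδ, mul_inv_cancel_left, mul_inv_cancel_left] at this
  · have : (desB (act τ δ π) : ℝ) ≤ desB π + 3 := by exact_mod_cast hle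
    linarith [hπ.2]

theorem card_filter_desB_eq_sum (y : ℝ) :
    (Finset.univ.filter fun π : BG n => (desB π : ℝ) ≤ y).card =
      ∑ p : ℤˣ × ℤˣ, ((signClass n p.1 p.2).filter fun π => (desB π : ℝ) ≤ y).card := by
  rw [Finset.card_eq_sum_card_fiberwise (f := fun π : BG n => (signProd π.2, Equiv.Perm.sign π.1))
    (t := Finset.univ) (fun _ _ => Finset.mem_coe.2 (Finset.mem_univ _))]
  refine Finset.sum_congr rfl fun p _ => congrArg _ ?_
  ext π
  simp only [Finset.mem_filter, Finset.mem_univ, true_and, mem_signClass, Prod.ext_iff]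
  tauto

theorem card_units_prod : (Finset.univ : Finset (ℤˣ × ℤˣ)).card = 4 := rfl

theorem card_filter_desB_le_four_mul (hn : 2 ≤ n) (e s : ℤˣ) (y : ℝ) :
    (Finset.univ.filter fun π : BG n => (desB π : ℝ) ≤ y).card ≤
      4 * ((signClass n e s).filter fun π => (desB π : ℝ) ≤ y + 3).card := by
  rw [card_filter_desB_eq_sum, ← card_units_prod, ← smul_eq_mul]
  exact Finset.sum_le_card_nsmul _ _ _ fun p _ => card_filter_desB_le hn _ _ _ _ y

theorem four_mul_card_filter_desB_le (hn : 2 ≤ n) (e s : ℤˣ) (y : ℝ) :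
    4 * ((signClass n e s).filter fun π => (desB π : ℝ) ≤ y).card ≤
      (Finset.univ.filter fun π : BG n => (desB π : ℝ) ≤ y + 3).card := by
  rw [card_filter_desB_eq_sum, ← card_units_prod, ← smul_eq_mul]
  exact Finset.card_nsmul_le_sum _ _ _ fun p _ => card_filter_desB_le hn _ _ _ _ y

theorem four_mul_card_signClass (hn : 2 ≤ n) (e s : ℤˣ) :
    4 * (signClass n e s).card = Fintype.card (BG n) := by
  have hall {S : Finset (BG n)} {y : ℝ} (hy : n ≤ y) :
      S.filter (fun π => (desB π : ℝ) ≤ y) = S :=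
    Finset.filter_true_of_mem fun π _ => le_trans (by exact_mod_cast desB_le π) hy
  have h1 := card_filter_desB_le_four_mul hn e s n
  have h2 := four_mul_card_filter_desB_le hn e s n
  rw [hall le_rfl, hall (by simp), Finset.card_univ] at h1 h2
  exact le_antisymm h2 h1

theorem card_signClass_pos (hn : 2 ≤ n) (e s : ℤˣ) : 0 < (signClass n e s).card := by
  have := four_mul_card_signClass hn e s
  have : 0 < Fintype.card (BG n) := Fintype.card_pos
  omega

/-- The distribution function of `desB` on all signed permutations. -/
noncomputable def desCDF (n : ℕ) (y : ℝ) : ℝ :=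
  ((Finset.univ.filter fun π : BG n => (desB π : ℝ) ≤ y).card : ℝ) / Fintype.card (BG n)

/-- The array of counts of `desB` over `signClass n e s`. -/
def desCount (e s : ℤˣ) (n k : ℕ) : ℕ := ((signClass n e s).filter fun π => desB π = k).card

theorem neg_one_pow_eq_neg_one_iff_not_even {m : ℕ} : (-1 : ℤˣ) ^ m = -1 ↔ ¬ Even m := by
  rw [Nat.not_even_iff_odd, neg_one_pow_eq_neg_one_iff_odd (by decide)]

theorem cBDesBDP_eq : cBDesBDP = desCount (-1) 1 := by
  funext n k
  unfold cBDesBDP desCount signClass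
  congr 1
  ext π
  have h := neg_one_pow_eq_one_iff_even (R := ℤˣ) (n := invDB π) (by decide)
  simp only [Finset.mem_filter, Finset.mem_univ, true_and, ← neg_one_pow_negs,
    ← neg_one_pow_invDB, neg_one_pow_eq_neg_one_iff_not_even, h, and_assoc]

theorem cBDesBDM_eq : cBDesBDM = desCount (-1) (-1) := by
  funext n k
  unfold cBDesBDM desCount signClass
  congr 1
  ext π
  simp only [Finset.mem_filter, Finset.mem_univ, true_and, ← neg_one_pow_negs,
    ← neg_one_pow_invDB, neg_one_pow_eq_neg_one_iff_not_even, and_assoc]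

variable (e s : ℤˣ)

theorem rowSum_desCount : rowSum (desCount e s) n = (signClass n e s).card := by
  have := tsum_mul_card_filter_eq (signClass n e s) desB (fun _ => 1)
  simpa [rowSum, desCount] using this

theorem rowMean_desCount (hn : 2 ≤ n) : rowMean (desCount e s) n = n / 2 := by
  have hpos : (0 : ℝ) < (signClass n e s).card := by exact_mod_cast card_signClass_pos hn e s
  have h := congrArg (Int.cast : ℤ → ℝ) (sum_two_mul_desB_sub e s hn)
  push_cast at h
  rw [Finset.sum_sub_distrib, ← Finset.mul_sum, Finset.sum_const, nsmul_eq_mul] at h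
  rw [rowMean, rowSum_desCount, div_eq_iff hpos.ne']
  unfold desCount
  rw [tsum_mul_card_filter_eq (signClass n e s) desB (fun k => (k : ℝ))]
  linarith

theorem rowVar_desCount (hn : 4 ≤ n) : rowVar (desCount e s) n = ((n : ℝ) + 1) / 12 := by
  have hpos : (0 : ℝ) < (signClass n e s).card := by
    exact_mod_cast card_signClass_pos (by omega) e s
  have h1 := congrArg (Int.cast : ℤ → ℝ) (sum_two_mul_desB_sub e s (by omega : 2 ≤ n))
  have h2 := congrArg (Int.cast : ℤ → ℝ) (sum_two_mul_desB_sub_sq e s hn)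
  push_cast at h1 h2
  have key : ∀ π ∈ signClass n e s, ((desB π : ℝ)) ^ 2 =
      1 / 4 * (2 * (desB π : ℝ) - n) ^ 2 + n / 2 * (2 * (desB π : ℝ) - n) + n ^ 2 / 4 :=
    fun π _ => by ring
  rw [rowVar, rowMean_desCount e s (by omega), rowSum_desCount, sub_eq_iff_eq_add,
    div_eq_iff hpos.ne']
  unfold desCount
  rw [tsum_mul_card_filter_eq (signClass n e s) desB (fun k => (k : ℝ) ^ 2),
    Finset.sum_congr rfl key, Finset.sum_add_distrib, Finset.sum_add_distrib, ← Finset.mul_sum,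
    ← Finset.mul_sum, h1, Finset.sum_const, nsmul_eq_mul]
  linear_combination h2 / 12

theorem rowCDF_desCount (y : ℝ) : rowCDF (desCount e s) n y =
    ((signClass n e s).filter fun π => (desB π : ℝ) ≤ y).card / (signClass n e s).card := by
  rw [rowCDF, rowSum_desCount]
  congr 1
  have := tsum_mul_card_filter_eq (signClass n e s) desB (fun k => if (k : ℝ) ≤ y then 1 else 0)
  rw [Finset.sum_boole] at this
  rw [← this]
  simp [desCount]

theorem desCDF_le_rowCDF (hn : 2 ≤ n) (y : ℝ) :
    desCDF n (y - 3) ≤ rowCDF (desCount e s) n y := by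
  have hpos : (0 : ℝ) < (signClass n e s).card := by exact_mod_cast card_signClass_pos hn e s
  have h := card_filter_desB_le_four_mul hn e s (y - 3)
  rw [sub_add_cancel] at h
  rw [rowCDF_desCount, desCDF, ← four_mul_card_signClass hn e s,
    div_le_div_iff₀ (by push_cast; linarith) hpos]
  have h' : _ ≤ _ := (Nat.cast_le (α := ℝ)).2 h
  push_cast at h' ⊢
  nlinarith

theorem rowCDF_le_desCDF (hn : 2 ≤ n) (y : ℝ) :
    rowCDF (desCount e s) n y ≤ desCDF n (y + 3) := by
  have hpos : (0 : ℝ) < (signClass n e s).card := by exact_mod_cast card_signClass_pos hn e s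
  have h := four_mul_card_filter_desB_le hn e s y
  rw [rowCDF_desCount, desCDF, ← four_mul_card_signClass hn e s,
    div_le_div_iff₀ hpos (by push_cast; linarith)]
  have h' : _ ≤ _ := (Nat.cast_le (α := ℝ)).2 h
  push_cast at h' ⊢
  nlinarith

theorem monotone_rowCDF_desCount : Monotone (rowCDF (desCount e s) n) := by
  intro x y hxy
  rw [rowCDF_desCount, rowCDF_desCount]
  gcongr

theorem rowCDF_desCount_nonneg (y : ℝ) : 0 ≤ rowCDF (desCount e s) n y := by
  rw [rowCDF_desCount]
  positivity

theorem rowCDF_desCount_le_one (y : ℝ) : rowCDF (desCount e s) n y ≤ 1 := by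
  rw [rowCDF_desCount]
  exact div_le_one_of_le₀ (by exact_mod_cast Finset.card_filter_le _ _) (by positivity)

end BG

/-- The `k`-th letter (1-indexed) of a real word, extended by `0`. -/
def wordExt {n : ℕ} (w : Fin n → ℝ) (k : ℕ) : ℝ :=
  if h : 1 ≤ k ∧ k ≤ n then w ⟨k - 1, by omega⟩ else 0

open Classical in
/-- The number of descents of a real word preceded by the letter `0`. -/
noncomputable def wordDes {n : ℕ} (w : Fin n → ℝ) : ℕ :=
  ((Finset.range n).filter fun k => wordExt w (k + 1) < wordExt w k).card

namespace BG

variable {n : ℕ}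

theorem wordExt_zero (w : Fin n → ℝ) : wordExt w 0 = 0 := by simp [wordExt]

theorem wordExt_succ (w : Fin n → ℝ) {k : ℕ} (hk : k < n) : wordExt w (k + 1) = w ⟨k, hk⟩ := by
  simp [wordExt, hk]

theorem lt_iff_lt_of_abs {x y : ℝ} {X Y : ℤ} (hx : x ≠ 0) (hy : y ≠ 0) (hX : X ≠ 0) (hY : Y ≠ 0)
    (hxX : x < 0 ↔ X < 0) (hyY : y < 0 ↔ Y < 0) (hne : |x| ≠ |y|) (hNe : |X| ≠ |Y|)
    (h : |x| < |y| ↔ |X| < |Y|) : x < y ↔ X < Y := by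
  rcases lt_or_gt_of_ne hx with a | a <;> rcases lt_or_gt_of_ne hy with b | b
  · have A := hxX.1 a
    have B := hyY.1 b
    rw [abs_of_neg a, abs_of_neg b] at h hne
    rw [abs_of_neg A, abs_of_neg B] at h hNe
    have h2 : y < x ↔ Y < X := by simpa using h
    have h3 : x ≠ y := fun e => hne (by rw [e])
    have h4 : X ≠ Y := fun e => hNe (by rw [e])
    rw [← not_iff_not, not_lt, not_lt, le_iff_lt_or_eq, le_iff_lt_or_eq, h2]
    simp [h3.symm, h4.symm]
  · have A := hxX.1 a
    have B := (not_congr hyY).1 b.not_gt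
    exact iff_of_true (a.trans b) (by omega)
  · have A := (not_congr hxX).1 a.not_gt
    have B := hyY.1 b
    exact iff_of_false (b.trans a).not_gt (by omega)
  · have A := (not_congr hxX).1 a.not_gt
    have B := (not_congr hyY).1 b.not_gt
    rwa [abs_of_pos a, abs_of_pos b, abs_of_pos (a := X) (by omega),
      abs_of_pos (a := Y) (by omega)] at h

/-- `π` is the standardization of the real word `w`. -/
def Standardizes (π : BG n) (w : Fin n → ℝ) : Prop :=
  (∀ i, w i ≠ 0) ∧ (∀ i j, i ≠ j → |w i| ≠ |w j|) ∧ (∀ i, w i < 0 ↔ bval π i < 0) ∧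
    ∀ i j, |w i| < |w j| ↔ |bval π i| < |bval π j|

theorem Standardizes.wordDes_eq {π : BG n} {w : Fin n → ℝ} (h : Standardizes π w) :
    wordDes w = desB π := by
  classical
  obtain ⟨h0, hne, hneg, habs⟩ := h
  unfold wordDes desB
  congr 1
  ext k
  simp only [Finset.mem_filter, Finset.mem_range, and_congr_right_iff]
  intro hk
  rw [wordExt_succ w hk, bvalExt_succ π hk]
  rcases k with _ | k
  · rw [wordExt_zero, bvalExt_zero, hneg]
  · have hij : (⟨k + 1, hk⟩ : Fin n) ≠ ⟨k, by omega⟩ := by simp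
    rw [wordExt_succ w (by omega), bvalExt_succ π (by omega)]
    exact lt_iff_lt_of_abs (h0 _) (h0 _) (bval_ne_zero _ _) (bval_ne_zero _ _) (hneg _) (hneg _)
      (hne _ _ hij) (abs_bval_ne π hij) (habs _ _)

theorem exists_standardizes {w : Fin n → ℝ} (h0 : ∀ i, w i ≠ 0)
    (hne : ∀ i j, i ≠ j → |w i| ≠ |w j|) : ∃ π : BG n, Standardizes π w := by
  classical
  let σ := Tuple.sort fun i => |w i|
  have hmono : StrictMono ((fun i => |w i|) ∘ σ) :=
    (Tuple.monotone_sort fun i => |w i|).strictMono_of_injective fun i j hij => by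
      by_contra hc
      exact hne _ _ (fun h => hc (σ.injective h)) hij
  refine ⟨(σ.symm, fun i => decide (w i < 0)), h0, hne, fun i => ?_, fun i j => ?_⟩
  · by_cases h : w i < 0 <;> simp [bval, h] <;> omega
  · rw [abs_bval, abs_bval, add_lt_add_iff_right, Nat.cast_lt, ← Fin.lt_def, ← hmono.lt_iff_lt]
    simp

/-- Permute the letters of a word by `τ`, then change the signs at the positions marked by `δ`. -/
def actWord (τ : Equiv.Perm (Fin n)) (δ : Fin n → Bool) (w : Fin n → ℝ) : Fin n → ℝ :=
  fun i => (if δ i then -1 else 1) * w (τ i)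

theorem Standardizes.act {π : BG n} {w : Fin n → ℝ} (h : Standardizes π w)
    (τ : Equiv.Perm (Fin n)) (δ : Fin n → Bool) :
    Standardizes (BG.act τ δ π) (actWord τ δ w) := by
  obtain ⟨h0, hne, hneg, habs⟩ := h
  have e (i) : |actWord τ δ w i| = |w (τ i)| := by
    unfold actWord
    split_ifs <;> simp
  have e' (i) : |bval (BG.act τ δ π) i| = |bval π (τ i)| := by
    rw [bval_act]
    split_ifs <;> simp
  refine ⟨fun i => ?_, fun i j hij => ?_, fun i => ?_, fun i j => ?_⟩
  · rw [← abs_ne_zero, e, abs_ne_zero]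
    exact h0 _
  · rw [e, e]
    exact hne _ _ (τ.injective.ne hij)
  · rw [bval_act, actWord]
    have h1 := hneg (τ i)
    have h2 := h0 (τ i)
    have h3 := bval_ne_zero π (τ i)
    split_ifs
    · rw [neg_one_mul, neg_one_mul, neg_lt_zero, neg_lt_zero, ← not_iff_not, not_lt, not_lt,
        le_iff_lt_or_eq, le_iff_lt_or_eq, h1]
      simp [h2, h3]
    · rwa [one_mul, one_mul]
  · rw [e, e, e', e']
    exact habs _ _

theorem sum_wordDes_actWord {w : Fin n → ℝ} (h0 : ∀ i, w i ≠ 0)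
    (hne : ∀ i j, i ≠ j → |w i| ≠ |w j|) (f : ℕ → ℝ) :
    ∑ g : BG n, f (wordDes (actWord g.1 g.2 w)) = ∑ π : BG n, f (desB π) := by
  obtain ⟨p, hp⟩ := exists_standardizes h0 hne
  refine Finset.sum_bijective (fun g => BG.act g.1 g.2 p) (Finite.injective_iff_bijective.1 ?_)
    (by simp) fun g _ => by rw [(hp.act g.1 g.2).wordDes_eq]
  rintro ⟨τ, δ⟩ ⟨τ', δ'⟩ h
  simp only [BG.act, Prod.mk.injEq, mul_right_inj] at h
  obtain ⟨rfl, h⟩ := h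
  refine Prod.ext rfl (funext fun i => ?_)
  simpa using congrFun h i

variable (ν : Measure ℝ) [IsProbabilityMeasure ν]

theorem measurePreserving_actWord (hν : MeasurePreserving (fun x => -x) ν ν)
    (τ : Equiv.Perm (Fin n)) (δ : Fin n → Bool) :
    MeasurePreserving (actWord τ δ) (Measure.pi fun _ => ν) (Measure.pi fun _ => ν) := by
  have h1 := measurePreserving_arrowCongr' (fun _ : Fin n => ν) (fun _ : Fin n => ν) τ.symm
    (MeasurableEquiv.refl ℝ) fun _ => MeasurePreserving.id ν
  have h2 := measurePreserving_pi (fun _ : Fin n => ν) (fun _ : Fin n => ν)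
    (f := fun i x => (if δ i then -1 else 1) * x) fun i => by
      cases δ i
      · simp only [Bool.false_eq_true, if_false, one_mul]
        exact MeasurePreserving.id ν
      · simpa using hν
  exact h2.comp h1

theorem measurable_wordExt (k : ℕ) : Measurable fun w : Fin n → ℝ => wordExt w k := by
  unfold wordExt
  split_ifs <;> fun_prop

theorem measurable_wordDes : Measurable (wordDes : (Fin n → ℝ) → ℕ) := by
  classical
  have : (wordDes : (Fin n → ℝ) → ℕ) = fun w => ∑ k ∈ Finset.range n,
      if wordExt w (k + 1) < wordExt w k then 1 else 0 := by
    funext w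
    simp [wordDes, Finset.sum_boole]
  rw [this]
  refine Finset.measurable_fun_sum _ fun k _ => Measurable.ite ?_ measurable_const measurable_const
  exact measurableSet_lt (measurable_wordExt _) (measurable_wordExt _)

theorem ae_generic [NullSingletonClass ν] :
    ∀ᵐ w ∂(Measure.pi fun _ : Fin n => ν), (∀ i, w i ≠ 0) ∧ ∀ i j, i ≠ j → |w i| ≠ |w j| := by
  have h0 (i : Fin n) : ∀ᵐ w ∂(Measure.pi fun _ : Fin n => ν), w i ≠ 0 :=
    (Measure.quasiMeasurePreserving_eval (fun _ : Fin n => ν) i).ae (p := fun x => x ≠ 0)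
      (by simp [ae_iff])
  refine eventually_and.2 ⟨eventually_all.2 h0, eventually_all.2 fun i => eventually_all.2 fun j =>
    ?_⟩
  by_cases hij : i = j
  · simp [hij]
  have hind : IndepFun (fun w : Fin n → ℝ => w i) (fun w => w j) (Measure.pi fun _ => ν) :=
    (iIndepFun_pi (μ := fun _ : Fin n => ν) (X := fun _ => id)
      fun _ => aemeasurable_id).indepFun hij
  rw [indepFun_iff_map_prod_eq_prod_map_map (measurable_pi_apply i).aemeasurable
    (measurable_pi_apply j).aemeasurable,
    (measurePreserving_eval (fun _ : Fin n => ν) i).map_eq,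
    (measurePreserving_eval (fun _ : Fin n => ν) j).map_eq] at hind
  have hset : MeasurableSet {p : ℝ × ℝ | |p.1| ≠ |p.2|} :=
    (measurableSet_eq_fun (by fun_prop) (by fun_prop)).compl
  have hprod : ∀ᵐ p ∂(ν.prod ν), |p.1| ≠ |p.2| := by
    rw [Measure.ae_prod_iff_ae_ae hset]
    refine Eventually.of_forall fun x => ?_
    have : {y : ℝ | ¬ |x| ≠ |y|} ⊆ {x, -x} := by
      intro y hy
      simp only [ne_eq, not_not, Set.mem_ofPred_eq] at hy
      rcases abs_eq_abs.1 hy with h | h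
      · exact .inl h.symm
      · exact .inr (by simp [h])
    exact measure_mono_null this (Set.Finite.measure_zero (by simp) ν)
  rw [← hind] at hprod
  have := ae_of_ae_map (by fun_prop) hprod
  filter_upwards [this] with w hw _ using hw

theorem integral_wordDes [NullSingletonClass ν] (hν : MeasurePreserving (fun x => -x) ν ν)
    {f : ℕ → ℝ} {C : ℝ} (hf : ∀ k, ‖f k‖ ≤ C) :
    ∫ w, f (wordDes w) ∂(Measure.pi fun _ : Fin n => ν)
      = (∑ π : BG n, f (desB π)) / Fintype.card (BG n) := by
  have hmeas : Measurable fun w : Fin n → ℝ => f (wordDes w) :=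
    (measurable_of_countable f).comp measurable_wordDes
  have hinv_act (g : BG n) : ∫ w, f (wordDes (actWord g.1 g.2 w)) ∂(Measure.pi fun _ : Fin n => ν)
      = ∫ w, f (wordDes w) ∂(Measure.pi fun _ : Fin n => ν) := by
    have h := measurePreserving_actWord ν hν g.1 g.2
    nth_rw 2 [← h.map_eq]
    rw [integral_map h.measurable.aemeasurable hmeas.aestronglyMeasurable]
  have hsum := integral_finsetSum (μ := Measure.pi fun _ : Fin n => ν) Finset.univ
    (f := fun (g : BG n) w => f (wordDes (actWord g.1 g.2 w))) fun g _ =>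
      Integrable.of_bound (hmeas.comp
        (measurePreserving_actWord ν hν g.1 g.2).measurable).aestronglyMeasurable C
        (Eventually.of_forall fun w => hf _)
  rw [Finset.sum_congr rfl fun g _ => hinv_act g, Finset.sum_const, Finset.card_univ, nsmul_eq_mul,
    integral_congr_ae (g := fun _ => ∑ π : BG n, f (desB π))
      ((ae_generic ν).mono fun w hw => sum_wordDes_actWord hw.1 hw.2 f)] at hsum
  simp only [integral_const, probReal_univ, one_smul] at hsum
  rw [eq_div_iff (by simp), hsum, mul_comm]

theorem measureReal_wordDes_le [NullSingletonClass ν] (hν : MeasurePreserving (fun x => -x) ν ν)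
    (y : ℝ) : (Measure.pi fun _ : Fin n => ν).real {w | (wordDes w : ℝ) ≤ y} = desCDF n y := by
  have h := integral_wordDes (n := n) ν hν (f := fun k => if (k : ℝ) ≤ y then 1 else 0) (C := 1)
    fun k => by split_ifs <;> simp
  rw [Finset.sum_boole] at h
  have hset : MeasurableSet {w : Fin n → ℝ | (wordDes w : ℝ) ≤ y} :=
    measurable_wordDes (measurableSet_le (measurable_of_countable (fun k : ℕ => (k : ℝ)))
      measurable_const)
  rw [desCDF, ← h, ← integral_indicator_one hset]
  rfl

end BG

namespace BG

variable {n : ℕ}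

/-- The uniform probability measure on `[-1, 1]`. -/
noncomputable def unifSymm : Measure ℝ := (2 : NNReal)⁻¹ • volume.restrict (Set.Icc (-1) 1)

instance isProbabilityMeasure_unifSymm : IsProbabilityMeasure unifSymm := by
  constructor
  simp only [unifSymm, Measure.smul_apply, Measure.restrict_apply_univ, Real.volume_Icc]
  norm_num [ENNReal.smul_def]
  exact ENNReal.inv_mul_cancel (by norm_num) (by norm_num)

instance nullSingletonClass_unifSymm : NullSingletonClass unifSymm where
  measure_singleton x := by simp [unifSymm]

theorem measurePreserving_neg_unifSymm : MeasurePreserving (fun x => -x) unifSymm unifSymm := by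
  have h := (Measure.measurePreserving_neg (volume : Measure ℝ)).restrict_preimage
    (measurableSet_Icc (a := (-1 : ℝ)) (b := 1))
  refine MeasurePreserving.smul_measure (R := NNReal) ?_ _
  simpa using! h

theorem ae_unifSymm_abs_le : ∀ᵐ x ∂unifSymm, |x| ≤ 1 := by
  refine Measure.ae_smul_measure ?_ _
  filter_upwards [ae_restrict_mem measurableSet_Icc] with x hx
  exact abs_le.2 hx

theorem integral_unifSymm {E : Type*} [NormedAddCommGroup E] [NormedSpace ℝ E] (g : ℝ → E) :
    ∫ x, g x ∂unifSymm = (2 : ℝ)⁻¹ • ∫ x in (-1)..1, g x := by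
  rw [unifSymm, integral_smul_nnreal_measure, intervalIntegral.integral_of_le (by norm_num),
    integral_Icc_eq_integral_Ioc]
  rfl

/-- The increment of a uniform walk modulo `2` is again uniform. -/
theorem integral_unifSymm_wrap {g : ℝ → ℂ} (hg : Continuous g) {u : ℝ} (hu : |u| ≤ 1) :
    ∫ v, g (v + 2 * (if v < u then 1 else 0) - 1 - u) ∂unifSymm = ∫ v, g v ∂unifSymm := by
  obtain ⟨hu1, hu2⟩ := abs_le.1 hu
  rw [integral_unifSymm, integral_unifSymm]
  congr 1
  have c1 : Set.EqOn (fun v => g (v + 2 * (if v < u then 1 else 0) - 1 - u))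
      (fun v => g (v + (1 - u))) (Set.Ioo (-1) u) := by
    intro v hv
    simp only [hv.2, if_true]
    congr 1
    ring
  have c2 : Set.EqOn (fun v => g (v + 2 * (if v < u then 1 else 0) - 1 - u))
      (fun v => g (v + (-1 - u))) (Set.Icc u 1) := by
    intro v hv
    simp only [not_lt.2 hv.1, if_false]
    congr 1
    ring
  have e1 : ∫ v in (-1)..u, g (v + 2 * (if v < u then 1 else 0) - 1 - u) = ∫ v in (-u)..1, g v := by
    rw [intervalIntegral.integral_congr_Ioo_of_le hu1 c1, intervalIntegral.integral_comp_add_right]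
    congr 1 <;> ring
  have e2 : ∫ v in u..1, g (v + 2 * (if v < u then 1 else 0) - 1 - u) =
      ∫ v in (-1)..(-u), g v := by
    rw [intervalIntegral.integral_congr (by rwa [Set.uIcc_of_le hu2]),
      intervalIntegral.integral_comp_add_right]
    congr 1 <;> ring
  have i1 : IntervalIntegrable (fun v => g (v + 2 * (if v < u then 1 else 0) - 1 - u)) volume
      (-1) u :=
    (intervalIntegrable_congr_uIoo (by rw [Set.uIoo_of_le hu1]; exact c1)).2
      ((hg.comp (continuous_id.add continuous_const)).intervalIntegrable _ _)
  have i2 : IntervalIntegrable (fun v => g (v + 2 * (if v < u then 1 else 0) - 1 - u)) volume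
      u 1 :=
    (intervalIntegrable_congr_uIoo (by
      rw [Set.uIoo_of_le hu2]; exact c2.mono Set.Ioo_subset_Icc_self)).2
      ((hg.comp (continuous_id.add continuous_const)).intervalIntegrable _ _)
  rw [← intervalIntegral.integral_add_adjacent_intervals i1 i2, e1, e2, add_comm,
    intervalIntegral.integral_add_adjacent_intervals (hg.intervalIntegrable _ _)
      (hg.intervalIntegrable _ _)]

/-- The centered walk `wₙ + 2 des(w) - n`. -/
noncomputable def wordWalk (w : Fin n → ℝ) : ℝ := wordExt w n + 2 * wordDes w - n

theorem measurable_wordWalk : Measurable (wordWalk : (Fin n → ℝ) → ℝ) :=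
  ((measurable_wordExt n).add (((measurable_of_countable (fun k : ℕ => (k : ℝ))).comp
    measurable_wordDes).const_mul 2)).sub_const _

theorem wordExt_insertNth (w : Fin n → ℝ) (v : ℝ) {k : ℕ} (hk : k ≤ n) :
    wordExt (Fin.insertNth (α := fun _ => ℝ) (Fin.last n) v w) k = wordExt w k := by
  rcases k with _ | k
  · rw [wordExt_zero, wordExt_zero]
  · rw [wordExt_succ _ (by omega), wordExt_succ w hk]
    have : (⟨k, by omega⟩ : Fin (n + 1)) = (Fin.last n).succAbove ⟨k, hk⟩ := by
      rw [Fin.succAbove_last]; rfl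
    rw [this, Fin.insertNth_apply_succAbove]

theorem wordExt_insertNth_last (w : Fin n → ℝ) (v : ℝ) :
    wordExt (Fin.insertNth (α := fun _ => ℝ) (Fin.last n) v w) (n + 1) = v := by
  rw [wordExt_succ _ (Nat.lt_succ_self n)]
  exact Fin.insertNth_apply_same (α := fun _ => ℝ) (Fin.last n) v w

theorem wordWalk_insertNth (w : Fin n → ℝ) (v : ℝ) :
    wordWalk (Fin.insertNth (α := fun _ => ℝ) (Fin.last n) v w) =
      wordWalk w + (v + 2 * (if v < wordExt w n then 1 else 0) - 1 - wordExt w n) := by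
  classical
  have hdes : wordDes (Fin.insertNth (α := fun _ => ℝ) (Fin.last n) v w) =
      wordDes w + if v < wordExt w n then 1 else 0 := by
    simp only [wordDes, Finset.card_filter]
    rw [Finset.sum_range_succ, wordExt_insertNth_last, wordExt_insertNth w v le_rfl]
    congr 1
    refine Finset.sum_congr rfl fun k hk => ?_
    have := Finset.mem_range.1 hk
    rw [wordExt_insertNth w v (by omega), wordExt_insertNth w v (by omega)]
  rw [wordWalk, wordWalk, wordExt_insertNth_last, hdes]
  push_cast
  ring

theorem ae_abs_wordExt_le (k : ℕ) :
    ∀ᵐ w ∂(Measure.pi fun _ : Fin n => unifSymm), |wordExt w k| ≤ 1 := by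
  unfold wordExt
  split_ifs with h
  · exact (Measure.quasiMeasurePreserving_eval (fun _ : Fin n => unifSymm) _).ae
      (p := fun x => |x| ≤ 1) ae_unifSymm_abs_le
  · simp

theorem integral_exp_wordWalk (t : ℝ) :
    ∫ w, Complex.exp (t * (wordWalk w : ℝ) * Complex.I) ∂(Measure.pi fun _ : Fin n => unifSymm) =
      charFun unifSymm t ^ n := by
  induction n with
  | zero =>
    have h (w : Fin 0 → ℝ) : wordWalk w = 0 := by
      simp [wordWalk, wordExt_zero, wordDes]
    simp [h]
  | succ n ih =>
    have hmp := (measurePreserving_piFinSuccAbove (fun _ : Fin (n + 1) => unifSymm)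
      (Fin.last n)).symm
    rw [← hmp.integral_comp']
    have hmeas : Measurable fun p : ℝ × (Fin n → ℝ) => Complex.exp (t * (wordWalk
        ((MeasurableEquiv.piFinSuccAbove (fun _ => ℝ) (Fin.last n)).symm p) : ℝ) * Complex.I) := by
      have := measurable_wordWalk.comp
        (MeasurableEquiv.piFinSuccAbove (fun _ => ℝ) (Fin.last n)).symm.measurable
      simp only [Function.comp_def] at this
      fun_prop
    rw [integral_prod_symm _ (Integrable.of_bound hmeas.aestronglyMeasurable 1
      (Eventually.of_forall fun p => by
        rw [← Complex.ofReal_mul, Complex.norm_exp_ofReal_mul_I]))]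
    have hinner : ∀ᵐ w ∂(Measure.pi fun _ : Fin n => unifSymm),
        ∫ v, Complex.exp (t * (wordWalk ((MeasurableEquiv.piFinSuccAbove (fun _ => ℝ)
          (Fin.last n)).symm (v, w)) : ℝ) * Complex.I) ∂unifSymm =
        Complex.exp (t * (wordWalk w : ℝ) * Complex.I) * charFun unifSymm t := by
      filter_upwards [ae_abs_wordExt_le n] with w hw
      have hcont : Continuous fun v : ℝ => Complex.exp (t * v * Complex.I) := by fun_prop
      rw [charFun_apply_real, ← integral_unifSymm_wrap hcont hw, ← integral_const_mul]
      refine integral_congr_ae (Eventually.of_forall fun v => ?_)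
      change Complex.exp (t * (wordWalk (Fin.insertNth (α := fun _ => ℝ) (Fin.last n) v w) : ℝ) *
        Complex.I) = Complex.exp _ * Complex.exp _
      rw [wordWalk_insertNth, ← Complex.exp_add]
      push_cast
      congr 1
      ring
    rw [integral_congr_ae hinner, integral_mul_const, ih, pow_succ]

/-- The law of the walk `wₙ + 2 des(w) - n`, scaled by `√(3 / n)`. -/
noncomputable def walkLaw (n : ℕ) : Measure ℝ :=
  (Measure.pi fun _ : Fin n => unifSymm).map fun w => (√n)⁻¹ * √3 * wordWalk w

theorem measurable_scaled_wordWalk :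
    Measurable fun w : Fin n → ℝ => (√n)⁻¹ * √3 * wordWalk w :=
  measurable_wordWalk.const_mul _

instance isProbabilityMeasure_walkLaw : IsProbabilityMeasure (walkLaw n) :=
  Measure.isProbabilityMeasure_map measurable_scaled_wordWalk.aemeasurable

theorem charFun_walkLaw (t : ℝ) :
    charFun (walkLaw n) t = charFun (unifSymm.map (√3 * ·)) ((√n)⁻¹ * t) ^ n := by
  rw [walkLaw, charFun_map_mul_comp measurable_wordWalk.aemeasurable, charFun_map_mul,
    charFun_apply_real, integral_map measurable_wordWalk.aemeasurable
      (Continuous.aestronglyMeasurable (by fun_prop)), integral_exp_wordWalk]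
  congr 2
  ring

theorem tendsto_charFun_walkLaw (t : ℝ) :
    Tendsto (fun n => charFun (walkLaw n) t) atTop (𝓝 (charFun (gaussianReal 0 1) t)) := by
  have h0 : ∫ x, √3 * x ∂unifSymm = 0 := by
    rw [integral_const_mul, integral_unifSymm, integral_id]
    norm_num
  have h1 : ∫ x, ((fun x => √3 * x) ^ 2 : ℝ → ℝ) x ∂unifSymm = 1 := by
    simp only [Pi.pow_apply, mul_pow]
    rw [integral_const_mul, integral_unifSymm, integral_pow]
    norm_num
  have h := tendsto_charFun_inv_sqrt_mul_pow (P := unifSymm) (X := fun x => √3 * x)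
    (by fun_prop) h0 h1 t
  simp only [charFun_walkLaw]
  convert h using 2
  rw [charFun_gaussianReal]
  congr 1
  push_cast
  ring

theorem tendsto_cdf_walkLaw (x : ℝ) :
    Tendsto (fun n => cdf (walkLaw n) x) atTop (𝓝 (cdf (gaussianReal 0 1) x)) := by
  have := nullSingletonClass_gaussianReal (μ := 0) (v := 1) one_ne_zero
  have hlim : Tendsto (β := ProbabilityMeasure ℝ) (fun n => ⟨walkLaw n, inferInstance⟩) atTop
      (𝓝 (⟨gaussianReal 0 1, inferInstance⟩ : ProbabilityMeasure ℝ)) :=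
    ProbabilityMeasure.tendsto_of_tendsto_charFun tendsto_charFun_walkLaw
  have h := ProbabilityMeasure.tendsto_measure_of_null_frontier_of_tendsto' hlim
    (E := Set.Iic x) (by rw [frontier_Iic]; exact this.measure_singleton x)
  simp only [cdf_eq_real, measureReal_def]
  exact (ENNReal.tendsto_toReal (measure_ne_top _ _)).comp h

theorem tendsto_cdf_walkLaw_comp {z : ℕ → ℝ} {x : ℝ} (hz : Tendsto z atTop (𝓝 x)) :
    Tendsto (fun n => cdf (walkLaw n) (z n)) atTop (𝓝 (cdf (gaussianReal 0 1) x)) := by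
  have := nullSingletonClass_gaussianReal (μ := 0) (v := 1) one_ne_zero
  exact (tendstoUniformly_of_monotone_of_tendsto (fun n => monotone_cdf (walkLaw n))
    (fun n => cdf_nonneg (walkLaw n)) (fun n => cdf_le_one (walkLaw n)) (monotone_cdf _)
    (continuous_cdf _) (tendsto_cdf_atBot _) (tendsto_cdf_atTop _)
    tendsto_cdf_walkLaw).tendsto_comp (continuous_cdf _).continuousAt hz

theorem cdf_walkLaw (x : ℝ) : cdf (walkLaw n) x =
    (Measure.pi fun _ : Fin n => unifSymm).real {w | (√n)⁻¹ * √3 * wordWalk w ≤ x} := by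
  rw [cdf_eq_real, walkLaw, map_measureReal_apply measurable_scaled_wordWalk measurableSet_Iic]
  rfl

theorem desCDF_le_cdf_walkLaw (n : ℕ) (y : ℝ) :
    desCDF n y ≤ cdf (walkLaw n) ((√n)⁻¹ * √3 * (2 * y - n + 1)) := by
  rw [cdf_walkLaw, ← measureReal_wordDes_le unifSymm measurePreserving_neg_unifSymm]
  refine ENNReal.toReal_mono (measure_ne_top _ _) (measure_mono_ae ?_)
  filter_upwards [ae_abs_wordExt_le n] with w hw h
  have h' : (wordDes w : ℝ) ≤ y := h
  refine mul_le_mul_of_nonneg_left ?_ (by positivity)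
  rw [wordWalk]
  linarith [(abs_le.1 hw).2]

theorem cdf_walkLaw_le_desCDF (hn : n ≠ 0) (y : ℝ) :
    cdf (walkLaw n) ((√n)⁻¹ * √3 * (2 * y - n - 1)) ≤ desCDF n y := by
  rw [cdf_walkLaw, ← measureReal_wordDes_le unifSymm measurePreserving_neg_unifSymm]
  refine ENNReal.toReal_mono (measure_ne_top _ _) (measure_mono_ae ?_)
  filter_upwards [ae_abs_wordExt_le n] with w hw h
  have hpos : 0 < (√n)⁻¹ * √3 := by positivity
  have h' := le_of_mul_le_mul_left h hpos
  rw [wordWalk] at h'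
  change (wordDes w : ℝ) ≤ y
  linarith [(abs_le.1 hw).1]

theorem tendsto_threshold (x c : ℝ) :
    Tendsto (fun n : ℕ => (√n)⁻¹ * √3 * (2 * (x * √(((n : ℝ) + 1) / 12)) + c)) atTop (𝓝 x) := by
  have h1 : Tendsto (fun n : ℕ => (√(n : ℝ))⁻¹) atTop (𝓝 0) :=
    (Real.tendsto_sqrt_atTop.comp tendsto_natCast_atTop_atTop).inv_tendsto_atTop
  have h2 : Tendsto (fun n : ℕ => √(1 + (n : ℝ)⁻¹)) atTop (𝓝 1) := by
    have : Tendsto (fun n : ℕ => 1 + (n : ℝ)⁻¹) atTop (𝓝 (1 + 0)) :=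
      tendsto_inv_atTop_nhds_zero_nat.const_add 1
    simpa using this.sqrt
  have h3 := (h2.const_mul x).add (h1.const_mul (√3 * c))
  rw [mul_one, mul_zero, add_zero] at h3
  refine h3.congr' ?_
  filter_upwards [eventually_ne_atTop 0] with n hn
  have hn' : (0 : ℝ) < n := by positivity
  have e : (√(n : ℝ))⁻¹ * √3 * (2 * √(((n : ℝ) + 1) / 12)) = √(1 + (n : ℝ)⁻¹) := by
    rw [show (2 : ℝ) = √4 by rw [show (4 : ℝ) = 2 ^ 2 by norm_num]; simp, ← Real.sqrt_inv,
      ← Real.sqrt_mul (by positivity), ← Real.sqrt_mul (by positivity),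
      ← Real.sqrt_mul (by positivity)]
    congr 1
    field_simp
    norm_num
  rw [← e]
  ring

theorem isAsympNormal_desCount (e s : ℤˣ) : IsAsympNormal (desCount e s) := by
  have := nullSingletonClass_gaussianReal (μ := 0) (v := 1) one_ne_zero
  have hpt (x : ℝ) : Tendsto (fun n => rowCDF (desCount e s) n
      (x * √(rowVar (desCount e s) n) + rowMean (desCount e s) n)) atTop
      (𝓝 (stdNormalCDF x)) := by
    rw [stdNormalCDF_eq_cdf]
    refine tendsto_of_tendsto_of_tendsto_of_le_of_le'
      (tendsto_cdf_walkLaw_comp (tendsto_threshold x (-7)))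
      (tendsto_cdf_walkLaw_comp (tendsto_threshold x 7)) ?_ ?_
    all_goals
      filter_upwards [eventually_ge_atTop 4] with n hn
      rw [rowVar_desCount e s hn, rowMean_desCount e s (by omega)]
    · refine le_trans ?_ (desCDF_le_rowCDF e s (by omega) _)
      refine le_trans (le_of_eq ?_) (cdf_walkLaw_le_desCDF (by omega) _)
      congr 2
      ring
    · refine (rowCDF_le_desCDF e s (by omega) _).trans ?_
      refine (desCDF_le_cdf_walkLaw _ _).trans (le_of_eq ?_)
      congr 2
      ring
  have hu : TendstoUniformly (fun n x => rowCDF (desCount e s) n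
      (x * √(rowVar (desCount e s) n) + rowMean (desCount e s) n)) stdNormalCDF atTop := by
    refine tendstoUniformly_of_monotone_of_tendsto (fun n x y hxy => ?_)
      (fun n x => rowCDF_desCount_nonneg e s _) (fun n x => rowCDF_desCount_le_one e s _)
      ?_ ?_ ?_ ?_ hpt
    · exact monotone_rowCDF_desCount e s (by gcongr)
    all_goals rw [stdNormalCDF_eq_cdf]
    · exact monotone_cdf _
    · exact continuous_cdf _
    · exact tendsto_cdf_atBot _
    · exact tendsto_cdf_atTop _
  rw [IsAsympNormal, Metric.tendsto_nhds]
  intro ε hε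
  filter_upwards [Metric.tendstoUniformly_iff.1 hu (ε / 2) (half_pos hε)] with n hn
  rw [dist_zero_right, Real.norm_of_nonneg (Real.iSup_nonneg fun _ => abs_nonneg _)]
  refine (ciSup_le fun x => ?_).trans_lt (half_lt_self hε)
  rw [abs_sub_comm]
  exact (hn x).le

end BG

/-- Theorem: the coefficients of `BDes_n^{B−D,±}(t)` are asymptotically normal; for `n ≥ 3`
the mean is `n/2` and for `n ≥ 4` the variance is `(n+1)/12`. -/
theorem typeBD_clt_bdes_plus_minus :
    IsAsympNormal cBDesBDP ∧ IsAsympNormal cBDesBDM ∧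
    (∀ n : ℕ, 3 ≤ n →
      rowMean cBDesBDP n = (n : ℝ) / 2 ∧ rowMean cBDesBDM n = (n : ℝ) / 2) ∧
    (∀ n : ℕ, 4 ≤ n →
      rowVar cBDesBDP n = ((n : ℝ) + 1) / 12 ∧ rowVar cBDesBDM n = ((n : ℝ) + 1) / 12) := by
  rw [BG.cBDesBDP_eq, BG.cBDesBDM_eq]
  exact ⟨BG.isAsympNormal_desCount _ _, BG.isAsympNormal_desCount _ _,
    fun n hn => ⟨BG.rowMean_desCount _ _ (by omega), BG.rowMean_desCount _ _ (by omega)⟩,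
    fun n hn => ⟨BG.rowVar_desCount _ _ hn, BG.rowVar_desCount _ _ hn⟩⟩
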